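/- Let a(z) = ∑_{j=−n₋}^{n₊} a_j z^j be a Laurent polynomial admitting a Wiener–Hopf factorization a(z) = u(z) l(1/z) with u, l polynomials nonvanishing on the closed unit disk, let v = 1/u and w = 1/l be the (absolutely summable) power-series inverses, and let b = a^{−1} denote the Laurent coefficient sequence of w(1/z)v(z), so that T(a)^{−1} = T(b) − H(w)H(v). Let v̂, ŵ be any polynomials (finitely supported power series), let b̂ be the Laurent coefficient sequence of ŵ(1/z)v̂(z), set B̂ = T(b̂) − H(ŵ)H(v̂), and let e_inv = a·b̂ − 1 (convolution of a and b̂ minus the identity of the Wiener algebra). Then the error ℰ := T(a)^{−1} − B̂ satisfies the exact identity ℰ = −T(b·e_inv) − [H(w − ŵ)H(v) + H(ŵ)H(v − v̂)], and consequently ‖T(b·e_inv)‖₂ ≤ ‖b‖_W ‖e_inv‖_W and ‖H(w − ŵ)H(v) + H(ŵ)H(v − v̂)‖₂ ≤ ‖w − ŵ‖_W ‖v‖_W + ‖v − v̂‖_W ‖ŵ‖_W. -/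

import Mathlib

/-- The bounded operator `T` on `ℓ²` is the Toeplitz operator with symbol coefficients
`a : ℤ → ℂ`, i.e. `(T x)_i = ∑_{j} a_{j-i} x_j` (indices in `ℕ`). -/
def IsToeplitzOp (T : lp (fun _ : ℕ => ℂ) 2 →L[ℂ] lp (fun _ : ℕ => ℂ) 2)
    (a : ℤ → ℂ) : Prop :=
  ∀ (x : lp (fun _ : ℕ => ℂ) 2) (i : ℕ), (T x) i = ∑' j : ℕ, a ((j : ℤ) - (i : ℤ)) * x j

/-- The bounded operator `H` on `ℓ²` is the Hankel operator `H(f)` of the power series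
with coefficients `f : ℕ → ℂ`, i.e. with entries `(H(f))_{i,j} = f_{i+j-1}` in 1-based
indexing (the constant term `f 0` is not used). -/
def IsHankelOpPS (H : lp (fun _ : ℕ => ℂ) 2 →L[ℂ] lp (fun _ : ℕ => ℂ) 2)
    (f : ℕ → ℂ) : Prop :=
  ∀ (x : lp (fun _ : ℕ => ℂ) 2) (i : ℕ), (H x) i = ∑' j : ℕ, f (i + j + 1) * x j

/-- Convolution on `ℤ`. -/
noncomputable def cnv (f g : ℤ → ℂ) (k : ℤ) : ℂ := ∑' m : ℤ, f m * g (k - m)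

/-- The unit of convolution. -/
noncomputable def dlt (k : ℤ) : ℂ := if k = 0 then 1 else 0

/-- Extension by zero of a one-sided sequence. -/
noncomputable def pex (f : ℕ → ℂ) (m : ℤ) : ℂ := if 0 ≤ m then f m.toNat else 0

theorem cnv_shear (f g : ℤ → ℂ) (hf : Summable fun k => ‖f k‖) (hg : Summable fun k => ‖g k‖) :
    Summable fun p : ℤ × ℤ => ‖f p.1‖ * ‖g (p.2 - p.1)‖ := by
  have h := hf.mul_of_nonneg hg (fun _ => norm_nonneg _) (fun _ => norm_nonneg _)
  let e : ℤ × ℤ ≃ ℤ × ℤ :=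
    { toFun := fun p => (p.1, p.2 - p.1)
      invFun := fun p => (p.1, p.2 + p.1)
      left_inv := fun p => by simp
      right_inv := fun p => by simp }
  exact (e.summable_iff.mpr h)

theorem cnv_term (f g : ℤ → ℂ) (hf : Summable fun k => ‖f k‖) (hg : Summable fun k => ‖g k‖)
    (k : ℤ) : Summable fun m => ‖f m * g (k - m)‖ := by
  have h := (cnv_shear f g hf hg).prod_symm.prod_factor k
  simpa [norm_mul] using h

theorem cnv_norm (f g : ℤ → ℂ) (hf : Summable fun k => ‖f k‖) (hg : Summable fun k => ‖g k‖) :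
    (Summable fun k => ‖cnv f g k‖) ∧
      ∑' k, ‖cnv f g k‖ ≤ (∑' k, ‖f k‖) * ∑' k, ‖g k‖ := by
  have hs := cnv_shear f g hf hg
  have hs' := hs.prod_symm
  have hle : ∀ k, ‖cnv f g k‖ ≤ ∑' m, ‖f m‖ * ‖g (k - m)‖ := fun k => by
    have := norm_tsum_le_tsum_norm (cnv_term f g hf hg k)
    simpa [norm_mul, cnv] using this
  have hsum : Summable fun k => ∑' m, ‖f m‖ * ‖g (k - m)‖ := hs'.prod
  have h1 : Summable fun k => ‖cnv f g k‖ :=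
    Summable.of_nonneg_of_le (fun _ => norm_nonneg _) hle hsum
  refine ⟨h1, (h1.tsum_le_tsum hle hsum).trans (le_of_eq ?_)⟩
  have hc : ∑' k, ∑' m, ‖f m‖ * ‖g (k - m)‖ = ∑' m, ∑' k, ‖f m‖ * ‖g (k - m)‖ :=
    Summable.tsum_comm (f := fun m k => ‖f m‖ * ‖g (k - m)‖) hs
  rw [hc, ← tsum_mul_right]
  congr 1
  ext m
  rw [tsum_mul_left]
  congr 1
  exact (Equiv.subRight m).tsum_eq (fun k => ‖g k‖)

theorem cnv_comm (f g : ℤ → ℂ) : cnv f g = cnv g f := by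
  ext k
  unfold cnv
  rw [← (Equiv.subLeft k).tsum_eq]
  simp [mul_comm]

theorem cnv_neg (f g : ℤ → ℂ) (k : ℤ) :
    cnv (fun m => f (-m)) (fun m => g (-m)) k = cnv f g (-k) := by
  unfold cnv
  rw [← (Equiv.neg ℤ).tsum_eq]
  simp only [Equiv.neg_apply, neg_neg]
  congr 1; ext m; congr 2; ring

theorem cnv_dlt (f : ℤ → ℂ) : cnv f dlt = f := by
  ext k
  unfold cnv dlt
  rw [tsum_eq_single k]
  · simp
  · intro m hm
    have : k - m ≠ 0 := by omega
    simp [this]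

theorem cnv_assoc (f g h : ℤ → ℂ) (hf : Summable fun k => ‖f k‖) (hg : Summable fun k => ‖g k‖)
    (hh : Summable fun k => ‖h k‖) : cnv (cnv f g) h = cnv f (cnv g h) := by
  ext k
  have hb : ∀ m, ‖h m‖ ≤ ∑' k, ‖h k‖ := fun m => hh.le_tsum m (fun _ _ => norm_nonneg _)
  have hS : Summable fun p : ℤ × ℤ => f p.1 * g (p.2 - p.1) * h (k - p.2) := by
    refine Summable.of_norm_bounded ((cnv_shear f g hf hg).mul_right (∑' k, ‖h k‖)) fun p => ?_
    rw [norm_mul, norm_mul]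
    exact mul_le_mul_of_nonneg_left (hb _) (by positivity)
  have hc : ∑' m, ∑' n, f n * g (m - n) * h (k - m) = ∑' n, ∑' m, f n * g (m - n) * h (k - m) :=
    Summable.tsum_comm (f := fun n m => f n * g (m - n) * h (k - m)) hS
  unfold cnv
  simp only [← tsum_mul_right]
  rw [hc]
  congr 1; ext n
  rw [← tsum_mul_left, ← (Equiv.addRight n).tsum_eq]
  congr 1; ext m
  simp only [Equiv.coe_addRight]
  rw [mul_assoc]
  congr 3
  · ring
  · ring

theorem pex_tsum {E : Type*} [NormedAddCommGroup E] (G : ℤ → E) (hG : ∀ m < 0, G m = 0) :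
    ∑' m : ℤ, G m = ∑' i : ℕ, G i := by
  refine (Function.Injective.tsum_eq (f := G) (g := fun i : ℕ => (i : ℤ)) Nat.cast_injective
    ?_).symm
  intro m hm
  by_contra hx
  apply hm
  apply hG
  by_contra h
  exact hx ⟨m.toNat, by simp; omega⟩

theorem pex_nat (f : ℕ → ℂ) (i : ℕ) : pex f (i : ℤ) = f i := by simp [pex]

theorem pex_of_neg (f : ℕ → ℂ) (m : ℤ) (h : m < 0) : pex f m = 0 := by
  simp [pex, not_le.mpr h]

theorem pex_summable (f : ℕ → ℂ) (hf : Summable fun k => ‖f k‖) :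
    Summable fun m => ‖pex f m‖ := by
  have hi : Function.Injective (fun i : ℕ => (i : ℤ)) := Nat.cast_injective
  refine (hi.summable_iff ?_).mp ?_
  · intro m hm
    rw [pex_of_neg, norm_zero]
    by_contra h
    exact hm ⟨m.toNat, by simp; omega⟩
  · simpa [Function.comp_def, pex_nat] using hf

theorem pex_neg_summable (f : ℕ → ℂ) (hf : Summable fun k => ‖f k‖) :
    Summable fun m => ‖pex f (-m)‖ :=
  (pex_summable f hf).comp_injective (i := fun m : ℤ => -m) neg_injective

theorem laurent_eq (v w : ℕ → ℂ) (hv : Summable fun k => ‖v k‖) (hw : Summable fun k => ‖w k‖)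
    (k : ℤ) : (∑' p : ℕ × ℕ, if (p.1 : ℤ) - (p.2 : ℤ) = k then v p.1 * w p.2 else 0)
      = cnv (pex v) (fun m => pex w (-m)) k := by
  have hS : Summable fun p : ℕ × ℕ =>
      if (p.1 : ℤ) - (p.2 : ℤ) = k then v p.1 * w p.2 else 0 := by
    refine Summable.of_norm_bounded
      (hv.mul_of_nonneg hw (fun _ => norm_nonneg _) (fun _ => norm_nonneg _)) fun p => ?_
    split_ifs
    · rw [norm_mul]
    · rw [norm_zero]; positivity
  rw [hS.tsum_prod]
  unfold cnv
  rw [pex_tsum _ (fun m hm => by rw [pex_of_neg v m hm, zero_mul])]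
  congr 1; ext i
  rw [pex_nat]
  by_cases h : k ≤ i
  · rw [tsum_eq_single ((i : ℤ) - k).toNat]
    · rw [if_pos (by simp; omega)]
      congr 1
      have hz : -(k - (i : ℤ)) = ((((i : ℤ) - k).toNat : ℕ) : ℤ) := by omega
      change _ = pex w (-(k - (i : ℤ)))
      rw [hz, pex_nat]
    · intro j hj
      rw [if_neg]; omega
  · change _ = v i * pex w (-(k - (i : ℤ)))
    rw [pex_of_neg w _ (by omega), mul_zero]
    refine (tsum_congr fun j => ?_).trans tsum_zero
    refine if_neg ?_
    change ¬ ((i : ℤ) - (j : ℤ) = k)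
    omega

theorem pex_inv (u v : ℕ → ℂ)
    (huv : ∀ n : ℕ, ∑ i ∈ Finset.range (n + 1), u i * v (n - i) = if n = 0 then 1 else 0) :
    cnv (pex u) (pex v) = dlt := by
  ext k
  unfold cnv
  rw [pex_tsum _ (fun m hm => by rw [pex_of_neg u m hm, zero_mul])]
  by_cases hk : 0 ≤ k
  · obtain ⟨n, rfl⟩ := Int.eq_ofNat_of_zero_le hk
    rw [tsum_eq_sum (s := Finset.range (n + 1))]
    · unfold dlt
      have := huv n
      simp only [Nat.cast_eq_zero]
      rw [← this]
      refine Finset.sum_congr rfl fun i hi => ?_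
      have hi' : i ≤ n := by simpa [Nat.lt_succ_iff] using hi
      rw [pex_nat, ← Nat.cast_sub hi', pex_nat]
    · intro i hi
      have hi' : n < i := by simpa using hi
      rw [pex_of_neg v _ (by omega), mul_zero]
  · unfold dlt
    rw [if_neg (by omega), ← tsum_zero (α := ℂ) (β := ℕ)]
    congr 1; ext i
    rw [pex_of_neg v _ (by omega), mul_zero]

theorem schur_bound (M : lp (fun _ : ℕ => ℂ) 2 →L[ℂ] lp (fun _ : ℕ => ℂ) 2)
    (K : ℕ → ℕ → ℂ) (C : ℝ) (hC : 0 ≤ C)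
    (hM : ∀ (x : lp (fun _ : ℕ => ℂ) 2) (i : ℕ), (M x) i = ∑' j : ℕ, K i j * x j)
    (hrow : ∀ (i : ℕ) (t : Finset ℕ), ∑ j ∈ t, ‖K i j‖ ≤ C)
    (hcol : ∀ (j : ℕ) (s : Finset ℕ), ∑ i ∈ s, ‖K i j‖ ≤ C) : ‖M‖ ≤ C := by
  refine M.opNorm_le_bound hC fun x => ?_
  have hx0 : 0 ≤ ‖x‖ := norm_nonneg _
  have hxs : ∀ t : Finset ℕ, ∑ j ∈ t, ‖x j‖ ^ 2 ≤ ‖x‖ ^ 2 := fun t => by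
    have := lp.sum_rpow_le_norm_rpow (p := 2) (by norm_num) x t
    simpa using this
  have hx1 : ∀ j, ‖x j‖ ≤ ‖x‖ := fun j => lp.norm_apply_le_norm (by norm_num) x j
  refine lp.norm_le_of_forall_sum_le (p := 2) (by norm_num) (by positivity) fun s => ?_
  simp only [ENNReal.toReal_ofNat, Real.rpow_ofNat]
  -- summability of rows
  have hrs : ∀ i, Summable fun j => ‖K i j * x j‖ := fun i => by
    refine summable_of_sum_le (c := C * ‖x‖) (fun _ => norm_nonneg _) fun t => ?_
    calc ∑ j ∈ t, ‖K i j * x j‖ ≤ ∑ j ∈ t, ‖K i j‖ * ‖x‖ := by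
          refine Finset.sum_le_sum fun j _ => ?_
          rw [norm_mul]
          exact mul_le_mul_of_nonneg_left (hx1 j) (norm_nonneg _)
      _ = (∑ j ∈ t, ‖K i j‖) * ‖x‖ := by rw [Finset.sum_mul]
      _ ≤ C * ‖x‖ := mul_le_mul_of_nonneg_right (hrow i t) hx0
  have hlim : Filter.Tendsto (fun t : Finset ℕ => ∑ i ∈ s, ‖∑ j ∈ t, K i j * x j‖ ^ 2)
      Filter.atTop (nhds (∑ i ∈ s, ‖(M x) i‖ ^ 2)) := by
    refine tendsto_finsetSum _ fun i _ => ?_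
    rw [hM x i]
    exact ((hrs i).of_norm.hasSum.norm).pow 2
  refine le_of_tendsto' hlim fun t => ?_
  have hcs : ∀ i, ‖∑ j ∈ t, K i j * x j‖ ^ 2 ≤ C * ∑ j ∈ t, ‖K i j‖ * ‖x j‖ ^ 2 := fun i => by
    have h1 : ‖∑ j ∈ t, K i j * x j‖ ≤ ∑ j ∈ t, ‖K i j‖ * ‖x j‖ := by
      refine (norm_sum_le _ _).trans (le_of_eq ?_)
      simp [norm_mul]
    have h2 : (∑ j ∈ t, ‖K i j‖ * ‖x j‖) ^ 2
        ≤ (∑ j ∈ t, ‖K i j‖) * ∑ j ∈ t, ‖K i j‖ * ‖x j‖ ^ 2 := by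
      refine Finset.sum_sq_le_sum_mul_sum_of_sq_le_mul t (fun j _ => norm_nonneg _)
        (fun j _ => by positivity) (fun j _ => le_of_eq (by ring))
    calc _ ≤ (∑ j ∈ t, ‖K i j‖ * ‖x j‖) ^ 2 := pow_le_pow_left₀ (norm_nonneg _) h1 2
      _ ≤ _ := h2
      _ ≤ _ := mul_le_mul_of_nonneg_right (hrow i t)
        (Finset.sum_nonneg fun j _ => by positivity)
  calc ∑ i ∈ s, ‖∑ j ∈ t, K i j * x j‖ ^ 2
      ≤ ∑ i ∈ s, C * ∑ j ∈ t, ‖K i j‖ * ‖x j‖ ^ 2 := Finset.sum_le_sum fun i _ => hcs i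
    _ = C * ∑ j ∈ t, (∑ i ∈ s, ‖K i j‖) * ‖x j‖ ^ 2 := by
        rw [← Finset.mul_sum, Finset.sum_comm]
        simp only [Finset.sum_mul]
    _ ≤ C * ∑ j ∈ t, C * ‖x j‖ ^ 2 := by
        refine mul_le_mul_of_nonneg_left (Finset.sum_le_sum fun j _ => ?_) hC
        exact mul_le_mul_of_nonneg_right (hcol j s) (by positivity)
    _ = C * (C * ∑ j ∈ t, ‖x j‖ ^ 2) := by rw [← Finset.mul_sum]
    _ ≤ C * (C * ‖x‖ ^ 2) := by gcongr; exact hxs t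
    _ = (C * ‖x‖) ^ 2 := by ring

theorem sum_inj_le {α : Type*} (f : α → ℂ) (hf : Summable fun k => ‖f k‖) (e : ℕ → α)
    (he : Function.Injective e) (t : Finset ℕ) : ∑ j ∈ t, ‖f (e j)‖ ≤ ∑' k, ‖f k‖ := by
  have := hf.sum_le_tsum (t.map ⟨e, he⟩) (fun _ _ => norm_nonneg _)
  simpa using this

theorem toeplitz_bound (T : lp (fun _ : ℕ => ℂ) 2 →L[ℂ] lp (fun _ : ℕ => ℂ) 2) (a : ℤ → ℂ)
    (ha : Summable fun k => ‖a k‖) (hT : IsToeplitzOp T a) : ‖T‖ ≤ ∑' k, ‖a k‖ :=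
  schur_bound T (fun i j => a ((j : ℤ) - i)) _ (tsum_nonneg fun _ => norm_nonneg _) hT
    (fun i t => sum_inj_le a ha (fun j : ℕ => (j : ℤ) - i) (fun x y h => by simpa using h) t)
    (fun j t => sum_inj_le a ha (fun i : ℕ => (j : ℤ) - i) (fun x y h => by simpa using h) t)

theorem hankel_bound (H : lp (fun _ : ℕ => ℂ) 2 →L[ℂ] lp (fun _ : ℕ => ℂ) 2) (f : ℕ → ℂ)
    (hf : Summable fun k => ‖f k‖) (hH : IsHankelOpPS H f) : ‖H‖ ≤ ∑' k, ‖f k‖ :=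
  schur_bound H (fun i j => f (i + j + 1)) _ (tsum_nonneg fun _ => norm_nonneg _) hH
    (fun i t => sum_inj_le f hf (fun j : ℕ => i + j + 1) (fun x y h => by simpa using h) t)
    (fun j t => sum_inj_le f hf (fun i : ℕ => i + j + 1) (fun x y h => by simpa using h) t)

theorem row_summable (f : ℕ → ℂ) (hf : Summable fun k => ‖f k‖)
    (x : lp (fun _ : ℕ => ℂ) 2) : Summable fun j => f j * x j := by
  refine Summable.of_norm_bounded (hf.mul_right ‖x‖) fun j => ?_
  rw [norm_mul]
  exact mul_le_mul_of_nonneg_left (lp.norm_apply_le_norm (by norm_num) x j) (norm_nonneg _)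

theorem hankel_sub (H H1 H2 : lp (fun _ : ℕ => ℂ) 2 →L[ℂ] lp (fun _ : ℕ => ℂ) 2) (f g : ℕ → ℂ)
    (hf : Summable fun k => ‖f k‖) (hg : Summable fun k => ‖g k‖)
    (hH : IsHankelOpPS H (f - g)) (h1 : IsHankelOpPS H1 f) (h2 : IsHankelOpPS H2 g) :
    H = H1 - H2 := by
  ext x i
  have e : (H1 - H2) x = H1 x - H2 x := rfl
  rw [e, lp.coeFn_sub, Pi.sub_apply, hH, h1, h2, ← Summable.tsum_sub]
  · simp [sub_mul]
  · exact row_summable (fun j => f (i + j + 1))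
      (hf.comp_injective (i := fun j => i + j + 1) (fun x y h => by simpa using h)) x
  · exact row_summable (fun j => g (i + j + 1))
      (hg.comp_injective (i := fun j => i + j + 1) (fun x y h => by simpa using h)) x

theorem toeplitz_sub (T T1 T2 : lp (fun _ : ℕ => ℂ) 2 →L[ℂ] lp (fun _ : ℕ => ℂ) 2) (f g : ℤ → ℂ)
    (hf : Summable fun k => ‖f k‖) (hg : Summable fun k => ‖g k‖)
    (hT : IsToeplitzOp T (f - g)) (h1 : IsToeplitzOp T1 f) (h2 : IsToeplitzOp T2 g) :
    T = T1 - T2 := by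
  ext x i
  have e : (T1 - T2) x = T1 x - T2 x := rfl
  rw [e, lp.coeFn_sub, Pi.sub_apply, hT, h1, h2, ← Summable.tsum_sub]
  · simp [sub_mul]
  · exact row_summable (fun j => f (j - i))
      (hf.comp_injective (i := fun j : ℕ => (j : ℤ) - i) (fun x y h => by simpa using h)) x
  · exact row_summable (fun j => g (j - i))
      (hg.comp_injective (i := fun j : ℕ => (j : ℤ) - i) (fun x y h => by simpa using h)) x

theorem fin_summable (f : ℕ → ℂ) (hf : Set.Finite {i : ℕ | f i ≠ 0}) :
    Summable fun k => ‖f k‖ := by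
  refine summable_of_hasFiniteSupport (hf.subset fun i hi => ?_)
  simpa using hi

/-- With `a` a Laurent polynomial having Wiener–Hopf factorization
`a(z) = u(z) l(1/z)`, `v = 1/u`, `w = 1/l`, and `b = a⁻¹` the Laurent coefficients of
`w(1/z) v(z)`, so that `T(a)⁻¹ = T(b) - H(w) H(v)`: for any polynomials `v̂, ŵ`, with
`b̂` the Laurent coefficients of `ŵ(1/z) v̂(z)`, `B̂ = T(b̂) - H(ŵ) H(v̂)`, and
`e_inv = a·b̂ - 1` (convolution), the error `ℰ = T(a)⁻¹ - B̂` satisfies the exact identity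
`ℰ = -T(b·e_inv) - [H(w - ŵ) H(v) + H(ŵ) H(v - v̂)]`, whence the norm bounds
`‖T(b·e_inv)‖₂ ≤ ‖b‖_W ‖e_inv‖_W` and
`‖H(w-ŵ)H(v) + H(ŵ)H(v-v̂)‖₂ ≤ ‖w-ŵ‖_W ‖v‖_W + ‖v-v̂‖_W ‖ŵ‖_W`. -/
theorem toeplitz_inverse_error_analysis
    (nm np : ℕ) (a : ℤ → ℂ)
    (hsupp : ∀ k : ℤ, (k < -(nm : ℤ) ∨ (np : ℤ) < k) → a k = 0)
    (u l : ℕ → ℂ)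
    (hu_supp : ∀ i : ℕ, np < i → u i = 0) (hl_supp : ∀ i : ℕ, nm < i → l i = 0)
    (hu_nv : ∀ z : ℂ, ‖z‖ ≤ 1 → ∑ i ∈ Finset.range (np + 1), u i * z ^ i ≠ 0)
    (hl_nv : ∀ z : ℂ, ‖z‖ ≤ 1 → ∑ i ∈ Finset.range (nm + 1), l i * z ^ i ≠ 0)
    (hfact : ∀ k : ℤ, a k =
      ∑ i ∈ Finset.range (np + 1), ∑ j ∈ Finset.range (nm + 1),
        if (i : ℤ) - (j : ℤ) = k then u i * l j else 0)
    -- the power-series inverses v = 1/u and w = 1/l, absolutely summable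
    (v w : ℕ → ℂ)
    (hv_sum : Summable fun k : ℕ => ‖v k‖) (hw_sum : Summable fun k : ℕ => ‖w k‖)
    (huv : ∀ n : ℕ, ∑ i ∈ Finset.range (n + 1), u i * v (n - i) = if n = 0 then 1 else 0)
    (hlw : ∀ n : ℕ, ∑ i ∈ Finset.range (n + 1), l i * w (n - i) = if n = 0 then 1 else 0)
    -- b = a⁻¹, the Laurent coefficients of w(1/z) v(z)
    (b : ℤ → ℂ)
    (hb : ∀ k : ℤ, b k = ∑' p : ℕ × ℕ,
      if (p.1 : ℤ) - (p.2 : ℤ) = k then v p.1 * w p.2 else 0)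
    -- the approximate inverses: polynomials v̂ and ŵ
    (vhat what : ℕ → ℂ)
    (hvhat_fin : Set.Finite {i : ℕ | vhat i ≠ 0})
    (hwhat_fin : Set.Finite {i : ℕ | what i ≠ 0})
    -- b̂, the Laurent coefficients of ŵ(1/z) v̂(z)
    (bhat : ℤ → ℂ)
    (hbhat : ∀ k : ℤ, bhat k = ∑' p : ℕ × ℕ,
      if (p.1 : ℤ) - (p.2 : ℤ) = k then vhat p.1 * what p.2 else 0)
    -- e_inv = a · b̂ - 1 in the Wiener algebra
    (einv : ℤ → ℂ)
    (heinv : ∀ k : ℤ, einv k =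
      (∑' m : ℤ, a m * bhat (k - m)) - (if k = 0 then 1 else 0))
    -- the convolution b · e_inv
    (beinv : ℤ → ℂ)
    (hbeinv : ∀ k : ℤ, beinv k = ∑' m : ℤ, b m * einv (k - m))
    -- the operators involved
    (Ta Tb Tbhat Tbeinv Hw Hv Hwhat Hvhat Hdw Hdv :
      lp (fun _ : ℕ => ℂ) 2 →L[ℂ] lp (fun _ : ℕ => ℂ) 2)
    (hTa : IsToeplitzOp Ta a) (hTb : IsToeplitzOp Tb b)
    (hTbhat : IsToeplitzOp Tbhat bhat) (hTbeinv : IsToeplitzOp Tbeinv beinv)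
    (hHw : IsHankelOpPS Hw w) (hHv : IsHankelOpPS Hv v)
    (hHwhat : IsHankelOpPS Hwhat what) (hHvhat : IsHankelOpPS Hvhat vhat)
    (hHdw : IsHankelOpPS Hdw (w - what)) (hHdv : IsHankelOpPS Hdv (v - vhat))
    -- so that T(b) - H(w)H(v) is the inverse of T(a)
    (hinv : Ta ∘L (Tb - Hw ∘L Hv) = 1 ∧ (Tb - Hw ∘L Hv) ∘L Ta = 1) :
    (Tb - Hw ∘L Hv) - (Tbhat - Hwhat ∘L Hvhat) =
        -Tbeinv - (Hdw ∘L Hv + Hwhat ∘L Hdv) ∧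
    ‖Tbeinv‖ ≤ (∑' k : ℤ, ‖b k‖) * (∑' k : ℤ, ‖einv k‖) ∧
    ‖Hdw ∘L Hv + Hwhat ∘L Hdv‖ ≤
      (∑' j : ℕ, ‖w j - what j‖) * (∑' j : ℕ, ‖v j‖) +
        (∑' j : ℕ, ‖v j - vhat j‖) * (∑' j : ℕ, ‖what j‖) := by
  have hu : Summable fun k => ‖u k‖ := fin_summable u
    ((Set.finite_le_nat np).subset fun i hi => by
      by_contra h; exact hi (hu_supp i (by simpa using h)))
  have hl : Summable fun k => ‖l k‖ := fin_summable l
    ((Set.finite_le_nat nm).subset fun i hi => by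
      by_contra h; exact hi (hl_supp i (by simpa using h)))
  have hvh := fin_summable vhat hvhat_fin
  have hwh := fin_summable what hwhat_fin
  have hb' : b = cnv (pex v) (fun m => pex w (-m)) := by
    ext k; rw [hb, laurent_eq v w hv_sum hw_sum]
  have hbh' : bhat = cnv (pex vhat) (fun m => pex what (-m)) := by
    ext k; rw [hbhat, laurent_eq vhat what hvh hwh]
  have ha' : a = cnv (pex u) (fun m => pex l (-m)) := by
    ext k
    rw [hfact, ← laurent_eq u l hu hl, tsum_eq_sum
      (s := Finset.range (np + 1) ×ˢ Finset.range (nm + 1)), Finset.sum_product]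
    rintro ⟨i, j⟩ hij
    simp only [Finset.mem_product, Finset.mem_range, not_and_or, not_lt] at hij
    rcases hij with h | h
    · simp [hu_supp i (by omega)]
    · simp [hl_supp j (by omega)]
  have sV := pex_summable v hv_sum
  have sU := pex_summable u hu
  have sW := pex_neg_summable w hw_sum
  have sL := pex_neg_summable l hl
  have sb : Summable fun k => ‖b k‖ := by rw [hb']; exact (cnv_norm _ _ sV sW).1
  have sa : Summable fun k => ‖a k‖ := by rw [ha']; exact (cnv_norm _ _ sU sL).1
  have sbh : Summable fun k => ‖bhat k‖ := by
    rw [hbh']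
    exact (cnv_norm _ _ (pex_summable _ hvh) (pex_neg_summable _ hwh)).1
  have hUV : cnv (pex u) (pex v) = dlt := pex_inv u v huv
  have hLW : cnv (fun m => pex l (-m)) (fun m => pex w (-m)) = dlt := by
    ext k
    rw [cnv_neg, pex_inv l w hlw]
    simp [dlt]
  have hba : cnv b a = dlt := by
    rw [hb', ha', cnv_comm (pex u), cnv_assoc _ _ _ sV sW (cnv_norm _ _ sL sU).1,
      ← cnv_assoc _ _ _ sW sL sU, cnv_comm _ (fun m => pex l (-m)), hLW, cnv_comm dlt, cnv_dlt,
      cnv_comm, hUV]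
  have sab := (cnv_norm a bhat sa sbh).1
  have sd : Summable fun k => ‖dlt k‖ := by
    refine summable_of_hasFiniteSupport ((Set.finite_singleton (0 : ℤ)).subset fun i hi => ?_)
    by_contra h
    apply hi
    have h' : i ≠ 0 := h
    simp [dlt, h']
  have he : einv = cnv a bhat - dlt := by
    ext k; rw [heinv]; rfl
  have se : Summable fun k => ‖einv k‖ := by
    refine Summable.of_nonneg_of_le (fun _ => norm_nonneg _) (fun k => ?_) (sab.add sd)
    rw [he]; exact norm_sub_le _ _
  have hbe : beinv = cnv b einv := by
    ext k; rw [hbeinv]; rfl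
  have hbe' : beinv = bhat - b := by
    have h1 : cnv b einv = cnv b (cnv a bhat) - cnv b dlt := by
      ext k
      rw [he, Pi.sub_apply]
      unfold cnv
      rw [← Summable.tsum_sub]
      · simp [mul_sub]
      · exact (cnv_term b (cnv a bhat) sb sab k).of_norm
      · exact (cnv_term b dlt sb sd k).of_norm
    rw [hbe, h1, ← cnv_assoc _ _ _ sb sa sbh, hba, cnv_comm dlt, cnv_dlt, cnv_dlt]
  have hT : Tbeinv = Tbhat - Tb :=
    toeplitz_sub _ _ _ bhat b sbh sb (hbe' ▸ hTbeinv) hTbhat hTb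
  have hW : Hdw = Hw - Hwhat := hankel_sub _ _ _ w what hw_sum hwh hHdw hHw hHwhat
  have hV : Hdv = Hv - Hvhat := hankel_sub _ _ _ v vhat hv_sum hvh hHdv hHv hHvhat
  refine ⟨?_, ?_, ?_⟩
  · rw [hT, hW, hV, ContinuousLinearMap.sub_comp, ContinuousLinearMap.comp_sub]
    abel
  · obtain ⟨h1, h2⟩ := cnv_norm b einv sb se
    rw [← hbe] at h1 h2
    exact (toeplitz_bound _ _ h1 hTbeinv).trans h2
  · have sdw : Summable fun k => ‖(w - what) k‖ :=
      Summable.of_nonneg_of_le (fun _ => norm_nonneg _) (fun k => norm_sub_le _ _)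
        (hw_sum.add hwh)
    have sdv : Summable fun k => ‖(v - vhat) k‖ :=
      Summable.of_nonneg_of_le (fun _ => norm_nonneg _) (fun k => norm_sub_le _ _)
        (hv_sum.add hvh)
    have b1 : ‖Hdw‖ ≤ ∑' j : ℕ, ‖w j - what j‖ := hankel_bound _ _ sdw hHdw
    have b2 : ‖Hdv‖ ≤ ∑' j : ℕ, ‖v j - vhat j‖ := hankel_bound _ _ sdv hHdv
    have b3 := hankel_bound _ _ hv_sum hHv
    have b4 := hankel_bound _ _ hwh hHwhat
    refine (norm_add_le _ _).trans (add_le_add ?_ ?_)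
    · exact (ContinuousLinearMap.opNorm_comp_le _ _).trans
        (mul_le_mul b1 b3 (norm_nonneg _) (tsum_nonneg fun _ => norm_nonneg _))
    · rw [mul_comm]
      exact (ContinuousLinearMap.opNorm_comp_le _ _).trans
        (mul_le_mul b4 b2 (norm_nonneg _) (tsum_nonneg fun _ => norm_nonneg _))
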